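/- Let k₀ ∈ (0, k₁), f(x) = k₀(x − d) and g(x) = f(−x) − h(−x). Then the function x ↦ g(x) − (k₁ − k₀)x is nondecreasing on ℝ, g is continuous and strictly increasing on ℝ, and h(x) = f(x) − g(−x) for all x ∈ ℝ. -/

import Mathlib

open Real Filter Set

/-- x-coordinate of the intersection of the lines y = k*x and y = -k₂/2 + k₁(x+1/2). -/
noncomputable def xstar (k1 k2 ks : ℝ) : ℝ := (k1 - k2) / (2 * (ks - k1))

/-- y-coordinate: y* = k* x*. -/
noncomputable def ystar (k1 k2 ks : ℝ) : ℝ := ks * xstar k1 k2 ks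

/-- The slope k⁺ = (y* + k₂)/(x* + 1). -/
noncomputable def kplus (k1 k2 ks : ℝ) : ℝ :=
  (ystar k1 k2 ks + k2) / (xstar k1 k2 ks + 1)

/-- The function ψ: equal to k₂x outside (-1, -1/2), and the min of the two lines inside. -/
noncomputable def psi (k1 k2 ks : ℝ) (x : ℝ) : ℝ :=
  if x ∈ Set.Ioo (-1 : ℝ) (-(1 / 2) : ℝ) then
    min (-k2 + kplus k1 k2 ks * (x + 1)) (-k2 / 2 + k1 * (x + 1 / 2))
  else k2 * x

/-- The rescaled functions ψ_j(x) = 2^(-j) ψ(2^j x). -/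
noncomputable def psij (k1 k2 ks : ℝ) (j : ℕ) (x : ℝ) : ℝ :=
  (2 : ℝ) ^ (-(j : ℤ)) * psi k1 k2 ks ((2 : ℝ) ^ j * x)

/-- η(x) = sup_{j ≥ 1} ψ_j(x). -/
noncomputable def eta (k1 k2 ks : ℝ) (x : ℝ) : ℝ :=
  ⨆ j : {j : ℕ // 1 ≤ j}, psij k1 k2 ks j x

/-- h(x) = η(x - d). -/
noncomputable def hfun (k1 k2 ks d : ℝ) (x : ℝ) : ℝ := eta k1 k2 ks (x - d)

/-- f(x) = k₀ (x - d). -/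
noncomputable def ffun (k0 d : ℝ) (x : ℝ) : ℝ := k0 * (x - d)

/-- g(x) = f(-x) - h(-x). -/
noncomputable def gfun (k0 k1 k2 ks d : ℝ) (x : ℝ) : ℝ :=
  ffun k0 d (-x) - hfun k1 k2 ks d (-x)

theorem lt_kplus {k1 k2 ks : ℝ} (hk12 : k1 < k2) (hks1 : (k1 + k2) / 2 < ks) (hks2 : ks < k2) :
    k2 < kplus k1 k2 ks := by
  have hpos : 0 < 2 * (ks - k1) := by linarith
  have hneg : xstar k1 k2 ks < 0 := div_neg_of_neg_of_pos (by linarith) hpos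
  have hgt : -1 < xstar k1 k2 ks := by
    rw [xstar, lt_div_iff₀ hpos]
    linarith
  rw [kplus, ystar, lt_div_iff₀ (by linarith)]
  nlinarith [mul_pos (neg_pos.2 hneg) (sub_pos.2 hks2)]

theorem psi_eq_max_min {k1 k2 ks : ℝ} (hk12 : k1 < k2) (hK : k2 < kplus k1 k2 ks) (x : ℝ) :
    psi k1 k2 ks x =
      max (k2 * x) (min (-k2 + kplus k1 k2 ks * (x + 1)) (-k2 / 2 + k1 * (x + 1 / 2))) := by
  unfold psi
  split_ifs with h
  · obtain ⟨h1, h2⟩ := h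
    refine (max_eq_right (le_min ?_ ?_)).symm
    · nlinarith [mul_pos (sub_pos.2 hK) (sub_pos.2 h1)]
    · nlinarith [mul_pos (sub_pos.2 hk12) (sub_pos.2 h2)]
  · refine (max_eq_left (min_le_iff.2 ?_)).symm
    rcases le_or_gt x (-1) with h1 | h1
    · left
      nlinarith [mul_nonneg (sub_pos.2 hK).le (sub_nonneg.2 h1)]
    · right
      have h2 : -(1 / 2) ≤ x := not_lt.1 fun h2 => h ⟨h1, h2⟩
      nlinarith [mul_nonneg (sub_pos.2 hk12).le (sub_nonneg.2 h2)]

/-- All difference quotients of `psi` lie between `k1` and `kplus`. -/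
theorem psi_sub_mem_Icc {k1 k2 ks : ℝ} (hk12 : k1 < k2) (hK : k2 < kplus k1 k2 ks) {x y : ℝ}
    (hxy : x ≤ y) :
    psi k1 k2 ks y - psi k1 k2 ks x ∈ Icc (k1 * (y - x)) (kplus k1 k2 ks * (y - x)) := by
  rw [psi_eq_max_min hk12 hK, psi_eq_max_min hk12 hK]
  generalize kplus k1 k2 ks = K at hK ⊢
  have h1 := mul_le_mul_of_nonneg_right hk12.le (sub_nonneg.2 hxy)
  have h2 := mul_le_mul_of_nonneg_right hK.le (sub_nonneg.2 hxy)
  constructor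
  · rw [le_sub_iff_add_le, ← max_add_add_left, ← min_add_add_left]
    refine max_le_max ?_ (min_le_min ?_ ?_) <;> linarith
  · rw [sub_le_iff_le_add, ← max_add_add_left, ← min_add_add_left]
    refine max_le_max ?_ (min_le_min ?_ ?_) <;> linarith

theorem psij_sub_mem_Icc {k1 k2 ks : ℝ} (hk12 : k1 < k2) (hK : k2 < kplus k1 k2 ks) (j : ℕ)
    {x y : ℝ} (hxy : x ≤ y) :
    psij k1 k2 ks j y - psij k1 k2 ks j x ∈ Icc (k1 * (y - x)) (kplus k1 k2 ks * (y - x)) := by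
  have hp : (0 : ℝ) < 2 ^ j := by positivity
  obtain ⟨h1, h2⟩ := psi_sub_mem_Icc hk12 hK (mul_le_mul_of_nonneg_left hxy hp.le)
  simp only [psij, zpow_neg, zpow_natCast, ← mul_sub]
  rw [← mul_sub, mul_left_comm] at h1 h2
  exact ⟨(le_inv_mul_iff₀ hp).2 h1, (inv_mul_le_iff₀ hp).2 h2⟩

theorem psij_zero (k1 k2 ks : ℝ) (j : ℕ) : psij k1 k2 ks j 0 = 0 := by
  have h : (0 : ℝ) ∉ Ioo (-1 : ℝ) (-(1 / 2)) := fun h => by linarith [h.2]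
  simp only [psij, psi, mul_zero, if_neg h]

theorem bddAbove_range_psij {k1 k2 ks : ℝ} (hk1 : 0 < k1) (hk12 : k1 < k2)
    (hK : k2 < kplus k1 k2 ks) (x : ℝ) :
    BddAbove (range fun j : {j : ℕ // 1 ≤ j} => psij k1 k2 ks j x) := by
  refine ⟨kplus k1 k2 ks * |x|, ?_⟩
  rintro _ ⟨j, rfl⟩
  have hK0 : 0 < kplus k1 k2 ks := hk1.trans (hk12.trans hK)
  rcases le_total 0 x with hx | hx
  · have h := (psij_sub_mem_Icc hk12 hK j hx).2
    rw [psij_zero, sub_zero, sub_zero] at h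
    rwa [abs_of_nonneg hx]
  · have h := (psij_sub_mem_Icc hk12 hK j hx).1
    rw [psij_zero] at h
    have h0 : 0 ≤ k1 * (0 - x) := mul_nonneg hk1.le (by linarith)
    have := mul_nonneg hK0.le (abs_nonneg x)
    dsimp only
    linarith

/-- All difference quotients of `eta` lie between `k1` and `kplus`. -/
theorem eta_sub_mem_Icc {k1 k2 ks : ℝ} (hk1 : 0 < k1) (hk12 : k1 < k2)
    (hK : k2 < kplus k1 k2 ks) {x y : ℝ} (hxy : x ≤ y) :
    eta k1 k2 ks y - eta k1 k2 ks x ∈ Icc (k1 * (y - x)) (kplus k1 k2 ks * (y - x)) := by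
  have : Nonempty {j : ℕ // 1 ≤ j} := ⟨⟨1, le_rfl⟩⟩
  have hle (j : {j : ℕ // 1 ≤ j}) (z : ℝ) : psij k1 k2 ks j z ≤ eta k1 k2 ks z :=
    le_ciSup (bddAbove_range_psij hk1 hk12 hK z) j
  constructor
  · have : eta k1 k2 ks x ≤ eta k1 k2 ks y - k1 * (y - x) :=
      ciSup_le fun j => by linarith [hle j y, (psij_sub_mem_Icc hk12 hK j hxy).1]
    linarith
  · have : eta k1 k2 ks y ≤ eta k1 k2 ks x + kplus k1 k2 ks * (y - x) :=
      ciSup_le fun j => by linarith [hle j x, (psij_sub_mem_Icc hk12 hK j hxy).2]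
    linarith

theorem continuous_eta {k1 k2 ks : ℝ} (hk1 : 0 < k1) (hk12 : k1 < k2)
    (hK : k2 < kplus k1 k2 ks) : Continuous (eta k1 k2 ks) := by
  refine (LipschitzWith.of_le_add_mul' (kplus k1 k2 ks) fun x y => ?_).continuous
  have hK0 : 0 < kplus k1 k2 ks := hk1.trans (hk12.trans hK)
  rcases le_total x y with h | h
  · have h1 := (eta_sub_mem_Icc hk1 hk12 hK h).1
    have h2 := mul_nonneg hk1.le (sub_nonneg.2 h)
    have h3 := mul_nonneg hK0.le (dist_nonneg (x := x) (y := y))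
    linarith
  · have h1 := (eta_sub_mem_Icc hk1 hk12 hK h).2
    rw [Real.dist_eq, abs_of_nonneg (sub_nonneg.2 h)]
    linarith

/-- g(x) − (k₁−k₀)x is nondecreasing, g is continuous and strictly
increasing, and h(x) = f(x) − g(−x) for all x. -/
theorem stmt_10 (k1 k2 ks d k0 : ℝ) (hk1 : 0 < k1) (hk12 : k1 < k2)
    (hks1 : (k1 + k2) / 2 < ks) (hks2 : ks < k2) (hd : 1 ≤ d)
    (hk00 : 0 < k0) (hk01 : k0 < k1) :
    Monotone (fun x => gfun k0 k1 k2 ks d x - (k1 - k0) * x) ∧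
    Continuous (gfun k0 k1 k2 ks d) ∧
    StrictMono (gfun k0 k1 k2 ks d) ∧
    (∀ x : ℝ, hfun k1 k2 ks d x = ffun k0 d x - gfun k0 k1 k2 ks d (-x)) := by
  have hK := lt_kplus hk12 hks1 hks2
  have hmono : Monotone (fun x => gfun k0 k1 k2 ks d x - (k1 - k0) * x) := by
    intro x y hxy
    have h := (eta_sub_mem_Icc hk1 hk12 hK (show -y - d ≤ -x - d by linarith)).1
    simp only [gfun, ffun, hfun]
    linarith
  refine ⟨hmono, ?_, ?_, ?_⟩
  · have := continuous_eta hk1 hk12 hK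
    unfold gfun ffun hfun
    fun_prop
  · intro x y hxy
    have h : gfun k0 k1 k2 ks d x - (k1 - k0) * x ≤ gfun k0 k1 k2 ks d y - (k1 - k0) * y :=
      hmono hxy.le
    have := mul_pos (sub_pos.2 hk01) (sub_pos.2 hxy)
    linarith
  · intro x
    simp only [gfun, neg_neg, sub_sub_cancel]
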